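/- Let (c_n) be a sequence in (−∞,0) with c_n → 0 and |c_n| m ≤ 1 for all n, and let (θ_n) be a sequence of nonzero reals with θ_n → 0. Then (1/θ_n) · ( ∫_{[0,m]} z ( ∫_ℝ x² h_{θ_n}(|c_n| Φ(x) z) φ(x) dx ) dν(z) − A ) → ( C0 − ∫_0^1 T(u) du ) A as n → ∞; i.e., the second-moment integral equals A + θ_n (C0 − ∫_0^1 T(u) du) A + o(θ_n). -/

import Mathlib

open MeasureTheory ProbabilityTheory Filter Set

/-- The standard normal distribution function `Φ`. -/
noncomputable def stdNormalCDF : ℝ → ℝ :=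
  fun x => ((gaussianReal 0 1) (Iic x)).toReal

lemma measurable_stdNormalCDF : Measurable stdNormalCDF := by
  refine Monotone.measurable fun x y hxy => ?_
  exact ENNReal.toReal_mono (measure_ne_top _ _) (measure_mono (Iic_subset_Iic.2 hxy))

lemma stdNormalCDF_pos (x : ℝ) : 0 < stdNormalCDF x := by
  refine ENNReal.toReal_pos (fun h0 => ?_) (measure_ne_top _ _)
  have := gaussianReal_absolutelyContinuous' 0 one_ne_zero h0
  simp at this

lemma stdNormalCDF_le_one (x : ℝ) : stdNormalCDF x ≤ 1 :=
  ENNReal.toReal_le_of_le_ofReal zero_le_one (by simpa using prob_le_one)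

lemma integrable_sq_stdGaussian : Integrable (fun x : ℝ => x ^ 2) (gaussianReal 0 1) :=
  (memLp_id_gaussianReal' 2 (by simp)).integrable_sq

lemma integral_sq_stdGaussian : ∫ x, x ^ 2 ∂(gaussianReal 0 1) = 1 := by
  have h := variance_of_integral_eq_zero (μ := gaussianReal 0 1) (X := id) aemeasurable_id
    (by simp)
  rw [variance_id_gaussianReal] at h
  simpa using h.symm

lemma integral_mul_gaussianPDFReal (g : ℝ → ℝ) :
    ∫ x, g x * gaussianPDFReal 0 1 x = ∫ x, g x ∂(gaussianReal 0 1) := by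
  rw [integral_gaussianReal_eq_integral_smul one_ne_zero]
  simp [mul_comm]

lemma scaled_stdNormalCDF_mem_Icc {κ m z : ℝ} (hκ : 0 ≤ κ) (hκm : κ * m ≤ 1)
    (hz : z ∈ Icc 0 m) (x : ℝ) : κ * stdNormalCDF x * z ∈ Icc (0 : ℝ) 1 := by
  have hΦ := stdNormalCDF_pos x
  refine ⟨mul_nonneg (mul_nonneg hκ hΦ.le) hz.1, le_trans ?_ hκm⟩
  exact mul_le_mul (mul_le_of_le_one_right hκ (stdNormalCDF_le_one x)) hz.2 hz.1 hκ

/-- The second moment of a standard Gaussian weighted by `f (κ Φ(x) z)`. -/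
noncomputable def weightedSecondMoment (f : ℝ → ℝ) (κ z : ℝ) : ℝ :=
  ∫ x, x ^ 2 * f (κ * stdNormalCDF x * z) ∂(gaussianReal 0 1)

section WeightedSecondMoment

variable {f : ℝ → ℝ} {B κ m z : ℝ}

lemma measurable_comp_scaled_stdNormalCDF (hf : Measurable f) :
    Measurable fun x => f (κ * stdNormalCDF x * z) :=
  hf.comp ((measurable_stdNormalCDF.const_mul κ).mul_const z)

lemma integrable_sq_mul_comp_scaled_stdNormalCDF (hf : Measurable f)
    (hB : ∀ u ∈ Icc (0 : ℝ) 1, |f u| ≤ B) (hκ : 0 ≤ κ) (hκm : κ * m ≤ 1) (hz : z ∈ Icc 0 m) :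
    Integrable (fun x => x ^ 2 * f (κ * stdNormalCDF x * z)) (gaussianReal 0 1) := by
  refine integrable_sq_stdGaussian.mul_bdd (c := B)
    (measurable_comp_scaled_stdNormalCDF hf).aestronglyMeasurable (ae_of_all _ fun x => ?_)
  exact hB _ (scaled_stdNormalCDF_mem_Icc hκ hκm hz x)

lemma measurable_weightedSecondMoment (hf : Measurable f) :
    Measurable (weightedSecondMoment f κ) := by
  refine (StronglyMeasurable.integral_prod_right (Measurable.stronglyMeasurable ?_)).measurable
  refine (measurable_snd.pow_const 2).mul (hf.comp ?_)
  exact ((measurable_stdNormalCDF.comp measurable_snd).const_mul κ).mul measurable_fst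

lemma abs_weightedSecondMoment_le (hB : ∀ u ∈ Icc (0 : ℝ) 1, |f u| ≤ B)
    (hκ : 0 ≤ κ) (hκm : κ * m ≤ 1) (hz : z ∈ Icc 0 m) :
    |weightedSecondMoment f κ z| ≤ B := by
  have h := norm_integral_le_of_norm_le (μ := gaussianReal 0 1)
    (f := fun x => x ^ 2 * f (κ * stdNormalCDF x * z)) (integrable_sq_stdGaussian.mul_const B)
    (ae_of_all _ fun x => by
      rw [norm_mul, Real.norm_of_nonneg (sq_nonneg x)]
      exact mul_le_mul_of_nonneg_left (hB _ (scaled_stdNormalCDF_mem_Icc hκ hκm hz x))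
        (sq_nonneg x))
  rwa [integral_mul_const, integral_sq_stdGaussian, one_mul] at h

lemma weightedSecondMoment_one_add_mul (hf : Measurable f)
    (hB : ∀ u ∈ Icc (0 : ℝ) 1, |f u| ≤ B) (hκ : 0 ≤ κ) (hκm : κ * m ≤ 1) (hz : z ∈ Icc 0 m)
    (t : ℝ) :
    weightedSecondMoment (fun u => 1 + t * f u) κ z = 1 + t * weightedSecondMoment f κ z := by
  have hi := integrable_sq_mul_comp_scaled_stdNormalCDF hf hB hκ hκm hz
  unfold weightedSecondMoment
  have hadd := integral_add integrable_sq_stdGaussian (hi.const_mul t)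
  rw [integral_sq_stdGaussian, integral_const_mul] at hadd
  rw [← hadd]
  exact integral_congr_ae (ae_of_all _ fun x => by ring)

lemma integrableOn_mul_weightedSecondMoment (ν : Measure ℝ) [IsFiniteMeasure ν]
    (hf : Measurable f) (hB : ∀ u ∈ Icc (0 : ℝ) 1, |f u| ≤ B) (hκ : 0 ≤ κ) (hκm : κ * m ≤ 1) :
    IntegrableOn (fun z => z * weightedSecondMoment f κ z) (Icc 0 m) ν := by
  refine Integrable.of_bound
    (measurable_id.mul (measurable_weightedSecondMoment hf)).aestronglyMeasurable (m * B)
    ((ae_restrict_iff' measurableSet_Icc).2 (ae_of_all _ fun z hz => ?_))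
  rw [norm_mul, Real.norm_of_nonneg hz.1]
  exact mul_le_mul hz.2 (abs_weightedSecondMoment_le hB hκ hκm hz) (norm_nonneg _)
    (hz.1.trans hz.2)

lemma setIntegral_mul_weightedSecondMoment_one_add_mul (ν : Measure ℝ) [IsFiniteMeasure ν]
    (hf : Measurable f) (hB : ∀ u ∈ Icc (0 : ℝ) 1, |f u| ≤ B) (hκ : 0 ≤ κ) (hκm : κ * m ≤ 1)
    (t : ℝ) :
    ∫ z in Icc 0 m, z * weightedSecondMoment (fun u => 1 + t * f u) κ z ∂ν
      = (∫ z in Icc 0 m, z ∂ν) + t * ∫ z in Icc 0 m, z * weightedSecondMoment f κ z ∂ν := by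
  have hid : IntegrableOn (fun z : ℝ => z) (Icc 0 m) ν :=
    continuous_id.continuousOn.integrableOn_Icc
  rw [← integral_const_mul, ← integral_add hid
    ((integrableOn_mul_weightedSecondMoment ν hf hB hκ hκm).const_mul t)]
  refine setIntegral_congr_fun measurableSet_Icc fun z hz => ?_
  simp only [weightedSecondMoment_one_add_mul hf hB hκ hκm hz]
  ring

end WeightedSecondMoment

lemma tendsto_weightedSecondMoment {f : ℕ → ℝ → ℝ} {B L m z : ℝ} {κ : ℕ → ℝ}
    (hf : ∀ n, Measurable (f n)) (hB : ∀ᶠ n in atTop, ∀ u ∈ Icc (0 : ℝ) 1, |f n u| ≤ B)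
    (hL : ∀ u : ℕ → ℝ, Tendsto u atTop (nhdsWithin 0 (Ioi 0)) →
      Tendsto (fun n => f n (u n)) atTop (nhds L))
    (hκ : ∀ n, 0 < κ n) (hκ0 : Tendsto κ atTop (nhds 0)) (hκm : ∀ n, κ n * m ≤ 1)
    (hz : z ∈ Icc 0 m) (hz0 : 0 < z) :
    Tendsto (fun n => weightedSecondMoment (f n) (κ n) z) atTop (nhds L) := by
  have key : Tendsto (fun n => weightedSecondMoment (f n) (κ n) z) atTop
      (nhds (∫ x, x ^ 2 * L ∂(gaussianReal 0 1))) := by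
    refine tendsto_integral_filter_of_dominated_convergence (fun x => x ^ 2 * B)
      (Eventually.of_forall fun n => ?_) ?_ (integrable_sq_stdGaussian.mul_const B)
      (ae_of_all _ fun x => ?_)
    · exact ((measurable_id.pow_const 2).mul
        (measurable_comp_scaled_stdNormalCDF (hf n))).aestronglyMeasurable
    · filter_upwards [hB] with n hn
      refine ae_of_all _ fun x => ?_
      rw [norm_mul, Real.norm_of_nonneg (sq_nonneg x)]
      exact mul_le_mul_of_nonneg_left
        (hn _ (scaled_stdNormalCDF_mem_Icc (hκ n).le (hκm n) hz x)) (sq_nonneg x)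
    · refine (hL _ (tendsto_nhdsWithin_iff.2 ⟨?_, Eventually.of_forall fun n =>
        mul_pos (mul_pos (hκ n) (stdNormalCDF_pos x)) hz0⟩)).const_mul _
      simpa using (hκ0.mul_const (stdNormalCDF x)).mul_const z
  rwa [integral_mul_const, integral_sq_stdGaussian, one_mul] at key

lemma tendsto_setIntegral_mul_weightedSecondMoment {f : ℕ → ℝ → ℝ} {B L m : ℝ} {κ : ℕ → ℝ}
    (ν : Measure ℝ) [IsFiniteMeasure ν]
    (hf : ∀ n, Measurable (f n)) (hB : ∀ᶠ n in atTop, ∀ u ∈ Icc (0 : ℝ) 1, |f n u| ≤ B)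
    (hL : ∀ u : ℕ → ℝ, Tendsto u atTop (nhdsWithin 0 (Ioi 0)) →
      Tendsto (fun n => f n (u n)) atTop (nhds L))
    (hκ : ∀ n, 0 < κ n) (hκ0 : Tendsto κ atTop (nhds 0)) (hκm : ∀ n, κ n * m ≤ 1) :
    Tendsto (fun n => ∫ z in Icc 0 m, z * weightedSecondMoment (f n) (κ n) z ∂ν) atTop
      (nhds (L * ∫ z in Icc 0 m, z ∂ν)) := by
  rw [mul_comm, ← integral_mul_const]
  refine tendsto_integral_filter_of_dominated_convergence (fun _ => m * B)
    (Eventually.of_forall fun n => ?_) ?_ (integrable_const _)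
    ((ae_restrict_iff' measurableSet_Icc).2 (ae_of_all _ fun z hz => ?_))
  · exact (measurable_id.mul (measurable_weightedSecondMoment (hf n))).aestronglyMeasurable
  · filter_upwards [hB] with n hn
    refine (ae_restrict_iff' measurableSet_Icc).2 (ae_of_all _ fun z hz => ?_)
    rw [norm_mul, Real.norm_of_nonneg hz.1]
    exact mul_le_mul hz.2 (abs_weightedSecondMoment_le hn (hκ n).le (hκm n) hz) (norm_nonneg _)
      (hz.1.trans hz.2)
  · rcases hz.1.eq_or_lt with rfl | hz0
    · simp
    · exact (tendsto_weightedSecondMoment hf hB hL hκ hκ0 hκm hz hz0).const_mul z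

lemma abs_exp_mul_sub_one_div_sub_le {t x K : ℝ} (ht : t ≠ 0) (hx : |x| ≤ K)
    (htK : |t| * K ≤ 1) : |(Real.exp (t * x) - 1) / t - x| ≤ |t| * K ^ 2 := by
  have hle : |t * x| ≤ |t| * K := by
    rw [abs_mul]
    exact mul_le_mul_of_nonneg_left hx (abs_nonneg t)
  have h := Real.abs_exp_sub_one_sub_id_le (hle.trans htK)
  have ht' : 0 < |t| := abs_pos.2 ht
  have heq : (Real.exp (t * x) - 1) / t - x = (Real.exp (t * x) - 1 - t * x) / t := by
    field_simp
  rw [heq, abs_div, div_le_iff₀ ht']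
  calc |Real.exp (t * x) - 1 - t * x| ≤ (t * x) ^ 2 := h
    _ = |t * x| ^ 2 := (sq_abs _).symm
    _ ≤ (|t| * K) ^ 2 := by gcongr
    _ = |t| * K ^ 2 * |t| := by ring

lemma normalized_exp_sub_one_div_eq {I e t : ℝ} (hI : I ≠ 0) (ht : t ≠ 0) :
    (I⁻¹ * e - 1) / t = ((e - 1) / t - (I - 1) / t) / I := by
  field_simp
  ring

section ExponentialFamily

variable {T : ℝ → ℝ} {K : ℝ}

lemma intervalIntegrable_of_abs_le_Icc {g : ℝ → ℝ} {B : ℝ} (hg : Measurable g)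
    (hB : ∀ u ∈ Icc (0 : ℝ) 1, |g u| ≤ B) : IntervalIntegrable g volume 0 1 := by
  rw [intervalIntegrable_iff_integrableOn_Ioc_of_le zero_le_one]
  exact Integrable.of_bound hg.aestronglyMeasurable B
    ((ae_restrict_iff' measurableSet_Ioc).2 (ae_of_all _ fun u hu => hB u (Ioc_subset_Icc_self hu)))

lemma intervalIntegrable_exp_mul (hT : Measurable T) (hK : ∀ u ∈ Icc (0 : ℝ) 1, |T u| ≤ K)
    (t : ℝ) : IntervalIntegrable (fun u => Real.exp (t * T u)) volume 0 1 := by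
  refine intervalIntegrable_of_abs_le_Icc (B := Real.exp (|t| * K)) (hT.const_mul t).exp
    fun u hu => ?_
  rw [Real.abs_exp, Real.exp_le_exp]
  refine (le_abs_self _).trans ?_
  rw [abs_mul]
  exact mul_le_mul_of_nonneg_left (hK u hu) (abs_nonneg t)

lemma abs_integral_exp_mul_sub_one_div_sub_le (hT : Measurable T)
    (hK : ∀ u ∈ Icc (0 : ℝ) 1, |T u| ≤ K) {t : ℝ} (ht : t ≠ 0) (htK : |t| * K ≤ 1) :
    |((∫ u in (0 : ℝ)..1, Real.exp (t * T u)) - 1) / t - ∫ u in (0 : ℝ)..1, T u|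
      ≤ |t| * K ^ 2 := by
  have hexp := intervalIntegrable_exp_mul hT hK t
  have hone : IntervalIntegrable (fun _ : ℝ => (1 : ℝ)) volume 0 1 := intervalIntegrable_const
  have heq : ((∫ u in (0 : ℝ)..1, Real.exp (t * T u)) - 1) / t - ∫ u in (0 : ℝ)..1, T u
      = ∫ u in (0 : ℝ)..1, ((Real.exp (t * T u) - 1) / t - T u) := by
    rw [intervalIntegral.integral_sub ((hexp.sub hone).div_const t)
        (intervalIntegrable_of_abs_le_Icc hT hK),
      intervalIntegral.integral_div, intervalIntegral.integral_sub hexp hone]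
    simp
  have h := intervalIntegral.norm_integral_le_of_norm_le_const (a := 0) (b := 1)
    (C := |t| * K ^ 2) (f := fun u => (Real.exp (t * T u) - 1) / t - T u) fun u hu => by
      rw [uIoc_of_le zero_le_one] at hu
      exact abs_exp_mul_sub_one_div_sub_le ht (hK u (Ioc_subset_Icc_self hu)) htK
  rw [heq]
  simpa using h

variable {θ : ℕ → ℝ}

lemma eventually_abs_mul_le_one (hθ0 : Tendsto θ atTop (nhds 0)) (K : ℝ) :
    ∀ᶠ n in atTop, |θ n| * K ≤ 1 := by
  have h : Tendsto (fun n => |θ n| * K) atTop (nhds 0) := by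
    simpa using hθ0.abs.mul_const K
  exact h.eventually_le_const one_pos

lemma tendsto_of_eventually_abs_sub_le_mul {a b : ℕ → ℝ} {l D : ℝ}
    (hθ0 : Tendsto θ atTop (nhds 0)) (hb : Tendsto b atTop (nhds l))
    (hab : ∀ᶠ n in atTop, |a n - b n| ≤ |θ n| * D) : Tendsto a atTop (nhds l) := by
  have h0 : Tendsto (fun n => |θ n| * D) atTop (nhds 0) := by
    simpa using hθ0.abs.mul_const D
  simpa using (squeeze_zero_norm' hab h0).add hb

lemma tendsto_integral_exp_mul_sub_one_div
    (hT : Measurable T) (hK : ∀ u ∈ Icc (0 : ℝ) 1, |T u| ≤ K)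
    (hθne : ∀ n, θ n ≠ 0) (hθ0 : Tendsto θ atTop (nhds 0)) :
    Tendsto (fun n => ((∫ u in (0 : ℝ)..1, Real.exp (θ n * T u)) - 1) / θ n) atTop
      (nhds (∫ u in (0 : ℝ)..1, T u)) := by
  refine tendsto_of_eventually_abs_sub_le_mul hθ0 tendsto_const_nhds (D := K ^ 2) ?_
  filter_upwards [eventually_abs_mul_le_one hθ0 K] with n hn
  exact abs_integral_exp_mul_sub_one_div_sub_le hT hK (hθne n) hn

lemma tendsto_integral_exp_mul
    (hT : Measurable T) (hK : ∀ u ∈ Icc (0 : ℝ) 1, |T u| ≤ K)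
    (hθne : ∀ n, θ n ≠ 0) (hθ0 : Tendsto θ atTop (nhds 0)) :
    Tendsto (fun n => ∫ u in (0 : ℝ)..1, Real.exp (θ n * T u)) atTop (nhds 1) := by
  have h := (hθ0.mul (tendsto_integral_exp_mul_sub_one_div hT hK hθne hθ0)).const_add 1
  rw [zero_mul, add_zero] at h
  refine h.congr fun n => ?_
  rw [mul_div_cancel₀ _ (hθne n)]
  ring

lemma eventually_abs_normalized_exp_sub_one_div_le
    (hT : Measurable T) (hK : ∀ u ∈ Icc (0 : ℝ) 1, |T u| ≤ K)
    (hθne : ∀ n, θ n ≠ 0) (hθ0 : Tendsto θ atTop (nhds 0)) :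
    ∃ B, ∀ᶠ n in atTop, ∀ u ∈ Icc (0 : ℝ) 1,
      |((∫ v in (0 : ℝ)..1, Real.exp (θ n * T v))⁻¹ * Real.exp (θ n * T u) - 1) / θ n| ≤ B := by
  have hI := tendsto_integral_exp_mul hT hK hθne hθ0
  have hR := (tendsto_integral_exp_mul_sub_one_div hT hK hθne hθ0).abs
  set s := ∫ u in (0 : ℝ)..1, T u
  refine ⟨(2 * K + (|s| + 1)) / (1 / 2), ?_⟩
  filter_upwards [eventually_abs_mul_le_one hθ0 K, hI.eventually_const_lt one_half_lt_one,
    hR.eventually_lt_const (lt_add_one |s|)] with n hn hIn hRn u hu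
  have hK0 : 0 ≤ K := (abs_nonneg _).trans (hK u hu)
  have hI0 : 0 < ∫ v in (0 : ℝ)..1, Real.exp (θ n * T v) := one_half_pos.trans hIn
  rw [normalized_exp_sub_one_div_eq hI0.ne' (hθne n), abs_div, abs_of_pos hI0]
  have hq : |(Real.exp (θ n * T u) - 1) / θ n| ≤ 2 * K := by
    have h1 := abs_exp_mul_sub_one_div_sub_le (hθne n) (hK u hu) hn
    have h2 := abs_sub_abs_le_abs_sub ((Real.exp (θ n * T u) - 1) / θ n) (T u)
    nlinarith [hK u hu]
  gcongr
  exact (abs_sub _ _).trans (add_le_add hq hRn.le)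

lemma tendsto_normalized_exp_sub_one_div {C0 : ℝ}
    (hT : Measurable T) (hK : ∀ u ∈ Icc (0 : ℝ) 1, |T u| ≤ K)
    (hθne : ∀ n, θ n ≠ 0) (hθ0 : Tendsto θ atTop (nhds 0))
    (hC0 : Tendsto T (nhdsWithin 0 (Ioi 0)) (nhds C0)) {u : ℕ → ℝ}
    (hu : Tendsto u atTop (nhdsWithin 0 (Ioi 0))) :
    Tendsto (fun n =>
      ((∫ v in (0 : ℝ)..1, Real.exp (θ n * T v))⁻¹ * Real.exp (θ n * T (u n)) - 1) / θ n) atTop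
      (nhds (C0 - ∫ v in (0 : ℝ)..1, T v)) := by
  have hI := tendsto_integral_exp_mul hT hK hθne hθ0
  have hR := tendsto_integral_exp_mul_sub_one_div hT hK hθne hθ0
  have hu01 : ∀ᶠ n in atTop, u n ∈ Ioc (0 : ℝ) 1 := hu (Ioc_mem_nhdsGT one_pos)
  have hq : Tendsto (fun n => (Real.exp (θ n * T (u n)) - 1) / θ n) atTop (nhds C0) := by
    refine tendsto_of_eventually_abs_sub_le_mul hθ0 (hC0.comp hu) (D := K ^ 2) ?_
    filter_upwards [eventually_abs_mul_le_one hθ0 K, hu01] with n hn hun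
    exact abs_exp_mul_sub_one_div_sub_le (hθne n) (hK _ (Ioc_subset_Icc_self hun)) hn
  have h := (hq.sub hR).div hI one_ne_zero
  rw [div_one] at h
  refine h.congr' ?_
  filter_upwards [hI.eventually_ne one_ne_zero] with n hn
  exact (normalized_exp_sub_one_div_eq hn (hθne n)).symm

end ExponentialFamily

/-- **Second-moment expansion in the exponential family model.**
With `h_θ(u) = C(θ) exp(θ T(u))`, `C0 = lim_{u↓0} T(u)` and `A = ∫_{[0,m]} z dν`:
for `c n < 0`, `c n → 0`, `|c n| m ≤ 1` and nonzero `θ n → 0`,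
`(1/θ n) ( ∫_{[0,m]} z ( ∫_ℝ x² h_{θ n}(|c n| Φ(x) z) φ(x) dx ) dν(z) − A )
  → (C0 − ∫_0^1 T(u) du) A`. -/
theorem second_moment_expansion_exponential_family
    (T : ℝ → ℝ) (hTmeas : Measurable T)
    (K : ℝ) (hTbdd : ∀ u ∈ Icc (0:ℝ) 1, |T u| ≤ K)
    (C0 : ℝ) (hC0 : Tendsto T (nhdsWithin 0 (Ioi 0)) (nhds C0))
    (C : ℝ → ℝ) (hC : ∀ θ, C θ = (∫ u in (0:ℝ)..1, Real.exp (θ * T u))⁻¹)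
    (h : ℝ → ℝ → ℝ) (hh : ∀ θ u, h θ u = C θ * Real.exp (θ * T u))
    (m : ℝ) (hm : 1 ≤ m)
    (ν : Measure ℝ) [IsProbabilityMeasure ν] (hν : ν (Icc (0:ℝ) m)ᶜ = 0)
    (A : ℝ) (hA : A = ∫ z in Icc (0:ℝ) m, z ∂ν)
    (c : ℕ → ℝ) (hcneg : ∀ n, c n < 0) (hc0 : Tendsto c atTop (nhds 0))
    (hcm : ∀ n, |c n| * m ≤ 1)
    (θ : ℕ → ℝ) (hθne : ∀ n, θ n ≠ 0) (hθ0 : Tendsto θ atTop (nhds 0)) :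
    Tendsto (fun n =>
        ((∫ z in Icc (0:ℝ) m,
            (z * ∫ x, x ^ 2 * h (θ n) (|c n| * stdNormalCDF x * z)
              * gaussianPDFReal 0 1 x) ∂ν) - A) / θ n) atTop
      (nhds ((C0 - ∫ u in (0:ℝ)..1, T u) * A)) := by
  obtain rfl : C = fun t => (∫ u in (0 : ℝ)..1, Real.exp (t * T u))⁻¹ := funext hC
  set f : ℕ → ℝ → ℝ := fun n u =>
    ((∫ v in (0 : ℝ)..1, Real.exp (θ n * T v))⁻¹ * Real.exp (θ n * T u) - 1) / θ n with hf_def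
  have hf : ∀ n, Measurable (f n) := fun n =>
    (((hTmeas.const_mul (θ n)).exp.const_mul _).sub_const 1).div_const (θ n)
  have hhf : ∀ n, h (θ n) = fun u => 1 + θ n * f n u := fun n => by
    funext u
    rw [hh, hf_def, mul_div_cancel₀ _ (hθne n), add_sub_cancel]
  obtain ⟨B, hB⟩ := eventually_abs_normalized_exp_sub_one_div_le hTmeas hTbdd hθne hθ0
  have hlim := tendsto_setIntegral_mul_weightedSecondMoment ν hf hB
    (fun u hu => tendsto_normalized_exp_sub_one_div hTmeas hTbdd hθne hθ0 hC0 hu)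
    (fun n => abs_pos.2 (hcneg n).ne) (by simpa using hc0.abs) hcm
  rw [← hA] at hlim
  refine hlim.congr' ?_
  filter_upwards [hB] with n hn
  simp only [integral_mul_gaussianPDFReal]
  change _ = ((∫ z in Icc 0 m, z * weightedSecondMoment (h (θ n)) |c n| z ∂ν) - A) / θ n
  rw [hhf n, setIntegral_mul_weightedSecondMoment_one_add_mul ν (hf n) hn (abs_nonneg _) (hcm n),
    ← hA, add_sub_cancel_left, mul_div_cancel_left₀ _ (hθne n)]
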